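/- Let p and q be primes, and n, r positive integers. If there exists a nondegenerate simplicial map from K(F_p^n) to K(ℤ^r) — a function f from one-dimensional subspaces of (F_p)^n to rank-1 direct summands of ℤ^r such that for every set {L_1,…,L_k} of distinct lines of (F_p)^n with dim(L_1+⋯+L_k) = k, the submodules f(L_1), …, f(L_k) are pairwise distinct and their sum is a rank-k direct summand of ℤ^r — then there exists a nondegenerate simplicial map from K(F_p^n) to K(F_q^r). Consequently ϑ_p(n) ≥ ς_{p,q}(n), where ϑ_p(n) (resp. ς_{p,q}(n)) denotes the least r admitting a nondegenerate map from K(F_p^n) to K(ℤ^r) (resp. to K(F_q^r)). -/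

import Mathlib

/-- `f` is a nondegenerate simplicial map from `K(F_p^n)` to `K(F_q^r)`. -/
def IsNondegMapK (p q n r : ℕ)
    (f : {L : Submodule (ZMod p) (Fin n → ZMod p) // Module.finrank (ZMod p) L = 1} →
         {L : Submodule (ZMod q) (Fin r → ZMod q) // Module.finrank (ZMod q) L = 1}) : Prop :=
  ∀ σ : Finset {L : Submodule (ZMod p) (Fin n → ZMod p) // Module.finrank (ZMod p) L = 1},
    Module.finrank (ZMod p) ↥(σ.sup (fun L => L.val)) = σ.card →
      Set.InjOn f ↑σ ∧
      Module.finrank (ZMod q) ↥(σ.sup (fun L => (f L).val)) = σ.card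

/-- `f` is a nondegenerate simplicial map from `K(F_p^n)` to `K(ℤ^r)`: it maps each set
of `k` distinct lines of `(F_p)^n` whose sum has dimension `k` injectively to `k`
distinct rank-1 direct summands of `ℤ^r` whose sum is a rank-`k` direct summand. -/
def IsNondegMapKZ (p n r : ℕ)
    (f : {L : Submodule (ZMod p) (Fin n → ZMod p) // Module.finrank (ZMod p) L = 1} →
         {L : Submodule ℤ (Fin r → ℤ) //
           Module.finrank ℤ L = 1 ∧ ∃ C, IsCompl L C}) : Prop :=
  ∀ σ : Finset {L : Submodule (ZMod p) (Fin n → ZMod p) // Module.finrank (ZMod p) L = 1},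
    Module.finrank (ZMod p) ↥(σ.sup (fun L => L.val)) = σ.card →
      Set.InjOn f ↑σ ∧
      Module.finrank ℤ ↥(σ.sup (fun L => (f L).val)) = σ.card ∧
      ∃ C, IsCompl (σ.sup (fun L => (f L).val)) C

/-- The reduction modulo `q` of a submodule of `ℤ^r`. -/
def reduceMod (q r : ℕ) (M : Submodule ℤ (Fin r → ℤ)) : Submodule (ZMod q) (Fin r → ZMod q) :=
  Submodule.span (ZMod q) ((Int.castAddHom (ZMod q)).toIntLinearMap.compLeft (Fin r) '' M)

lemma reduceMod_sup (q r : ℕ) (M N : Submodule ℤ (Fin r → ℤ)) :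
    reduceMod q r (M ⊔ N) = reduceMod q r M ⊔ reduceMod q r N := by
  unfold reduceMod
  rw [← Submodule.span_union]
  apply le_antisymm
  · rw [Submodule.span_le]
    rintro _ ⟨x, hx, rfl⟩
    obtain ⟨y, hy, z, hz, rfl⟩ := Submodule.mem_sup.1 hx
    rw [map_add]
    exact add_mem (Submodule.subset_span (Or.inl ⟨y, hy, rfl⟩))
      (Submodule.subset_span (Or.inr ⟨z, hz, rfl⟩))
  · rw [← Set.image_union]
    refine Submodule.span_mono (Set.image_mono (Set.union_subset ?_ ?_))
    · exact SetLike.coe_subset_coe.2 le_sup_left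
    · exact SetLike.coe_subset_coe.2 le_sup_right

lemma reduceMod_bot (q r : ℕ) : reduceMod q r ⊥ = ⊥ := by
  simp [reduceMod]

lemma reduceMod_top (q r : ℕ) : reduceMod q r ⊤ = ⊤ := by
  rw [reduceMod, eq_top_iff]
  intro x _
  refine Submodule.subset_span ?_
  choose y hy using fun i => ZMod.intCast_surjective (x i)
  exact ⟨y, trivial, funext hy⟩

lemma reduceMod_finset_sup (q r : ℕ) {ι : Type*} (s : Finset ι)
    (M : ι → Submodule ℤ (Fin r → ℤ)) :
    reduceMod q r (s.sup M) = s.sup fun i => reduceMod q r (M i) :=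
  Finset.apply_sup_eq_sup_comp _ (reduceMod_sup q r) (reduceMod_bot q r)

lemma finrank_reduceMod_le (q r : ℕ) [Fact q.Prime] (M : Submodule ℤ (Fin r → ℤ)) :
    Module.finrank (ZMod q) (reduceMod q r M) ≤ Module.finrank ℤ M := by
  let φ := (Int.castAddHom (ZMod q)).toIntLinearMap.compLeft (Fin r)
  let b := Module.finBasis ℤ M
  have h : reduceMod q r M ≤ Submodule.span (ZMod q) (Set.range fun i => φ (b i)) := by
    rw [reduceMod, Submodule.span_le]
    rintro _ ⟨x, hx, rfl⟩
    have hsum : x = ∑ i, b.repr ⟨x, hx⟩ i • (b i : Fin r → ℤ) := by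
      have := congrArg M.subtype (b.sum_repr ⟨x, hx⟩)
      rw [map_sum] at this
      exact this.symm
    change φ x ∈ _
    rw [hsum, map_sum]
    refine sum_mem fun i _ => ?_
    rw [map_zsmul]
    exact zsmul_mem (Submodule.subset_span (Set.mem_range_self i)) _
  refine (Submodule.finrank_mono h).trans ((finrank_range_le_card _).trans ?_)
  simp

lemma finrank_reduceMod_of_isCompl (q r : ℕ) [Fact q.Prime] {M C : Submodule ℤ (Fin r → ℤ)}
    (h : IsCompl M C) : Module.finrank (ZMod q) (reduceMod q r M) = Module.finrank ℤ M := by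
  have hM := finrank_reduceMod_le q r M
  have hC := finrank_reduceMod_le q r C
  have hsum : Module.finrank ℤ M + Module.finrank ℤ C = r := by
    rw [← Module.finrank_prod, (Submodule.prodEquivOfIsCompl M C h).finrank_eq]
    simp
  have htop := Submodule.finrank_add_le_finrank_add_finrank (reduceMod q r M) (reduceMod q r C)
  rw [← reduceMod_sup, h.sup_eq_top, reduceMod_top, finrank_top, Module.finrank_fin_fun] at htop
  omega

lemma finrank_finset_sup_le_sum {K V ι : Type*} [Field K] [AddCommGroup V] [Module K V]
    [FiniteDimensional K V] (s : Finset ι) (W : ι → Submodule K V) :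
    Module.finrank K ↥(s.sup W) ≤ ∑ i ∈ s, Module.finrank K (W i) := by
  classical
  induction s using Finset.induction_on with
  | empty => simp
  | insert a s ha ih =>
    rw [Finset.sup_insert, Finset.sum_insert ha]
    exact (Submodule.finrank_add_le_finrank_add_finrank _ _).trans (by gcongr)

/-- A family of lines spanning a subspace of dimension its cardinality has no repetition. -/
lemma injOn_of_finrank_finset_sup_eq_card {K V ι : Type*} [Field K] [AddCommGroup V] [Module K V]
    [FiniteDimensional K V] (s : Finset ι)
    (W : ι → {L : Submodule K V // Module.finrank K L = 1})
    (h : Module.finrank K ↥(s.sup fun i => (W i).val) = s.card) : Set.InjOn W s := by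
  classical
  refine Finset.card_image_iff.1 (le_antisymm Finset.card_image_le ?_)
  have hle := finrank_finset_sup_le_sum (s.image W) Subtype.val
  rw [Finset.sup_image, Finset.sum_congr rfl fun L _ => L.2] at hle
  simpa [Function.comp_def, h] using hle

lemma exists_isNondegMapK_of_isNondegMapKZ (p q n r : ℕ) (hq : q.Prime)
    (h : ∃ f, IsNondegMapKZ p n r f) : ∃ g, IsNondegMapK p q n r g := by
  have := Fact.mk hq
  obtain ⟨f, hf⟩ := h
  refine ⟨fun L => ⟨reduceMod q r (f L).val, ?_⟩, fun σ hσ => ?_⟩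
  · obtain ⟨hL, C, hC⟩ := (f L).2
    rw [finrank_reduceMod_of_isCompl q r hC, hL]
  · obtain ⟨-, hcard, C, hC⟩ := hf σ hσ
    rw [← finrank_reduceMod_of_isCompl q r hC, reduceMod_finset_sup] at hcard
    exact ⟨injOn_of_finrank_finset_sup_eq_card σ _ hcard, hcard⟩

section Coordinate

variable {r : ℕ}

lemma finset_sup_span_single {ι : Type*} (e : ι → Fin r) (s : Finset ι) :
    (s.sup fun i => Submodule.span ℤ {Pi.basisFun ℤ (Fin r) (e i)}) =
      Submodule.span ℤ (Pi.basisFun ℤ (Fin r) '' (e '' s)) := by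
  rw [Finset.sup_eq_iSup, Set.image_image, ← Set.biUnion_of_singleton (_ '' _), Set.biUnion_image,
    Submodule.span_iUnion₂]
  rfl

lemma isCompl_span_basisFun (s : Set (Fin r)) :
    IsCompl (Submodule.span ℤ (Pi.basisFun ℤ (Fin r) '' s))
      (Submodule.span ℤ (Pi.basisFun ℤ (Fin r) '' sᶜ)) := by
  refine ⟨(Pi.basisFun ℤ (Fin r)).linearIndependent.disjoint_span_image disjoint_compl_right, ?_⟩
  rw [codisjoint_iff, ← Submodule.span_union, ← Set.image_union, Set.union_compl_self,
    Set.image_univ, Module.Basis.span_eq]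

lemma finrank_span_basisFun (s : Finset (Fin r)) :
    Module.finrank ℤ (Submodule.span ℤ (Pi.basisFun ℤ (Fin r) '' s)) = s.card := by
  have hs : Pi.basisFun ℤ (Fin r) '' s =
      Set.range (Pi.basisFun ℤ (Fin r) ∘ (Subtype.val : s → _)) := by
    rw [Set.range_comp]
    simp
  rw [hs, finrank_span_eq_card
    ((Pi.basisFun ℤ (Fin r)).linearIndependent.comp _ Subtype.val_injective), Fintype.card_coe]

end Coordinate

/-- Sending the lines of `(F_p)^n` to distinct coordinate lines is nondegenerate. -/
lemma exists_isNondegMapKZ (p n : ℕ) (hp : p.Prime) (hn : 0 < n) :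
    ∃ r, 0 < r ∧ ∃ f, IsNondegMapKZ p n r f := by
  classical
  have := Fact.mk hp
  let X := {L : Submodule (ZMod p) (Fin n → ZMod p) // Module.finrank (ZMod p) L = 1}
  have : Finite (Submodule (ZMod p) (Fin n → ZMod p)) :=
    Finite.of_injective _ SetLike.coe_injective
  let e : X ≃ Fin (Nat.card X) := Finite.equivFin X
  have hX : Nonempty X :=
    ⟨⟨Submodule.span (ZMod p) {Pi.single ⟨0, hn⟩ 1}, finrank_span_singleton (by simp)⟩⟩
  have key (s : Finset X) :
      Module.finrank ℤ ↥(s.sup fun L => Submodule.span ℤ {Pi.basisFun ℤ _ (e L)}) = s.card ∧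
      ∃ C, IsCompl (s.sup fun L => Submodule.span ℤ {Pi.basisFun ℤ _ (e L)}) C := by
    rw [finset_sup_span_single]
    refine ⟨?_, _, isCompl_span_basisFun _⟩
    rw [← Finset.coe_image, finrank_span_basisFun, Finset.card_image_of_injective _ e.injective]
  refine ⟨Nat.card X, Nat.card_pos, fun L => ⟨Submodule.span ℤ {Pi.basisFun ℤ _ (e L)}, ?_⟩,
    fun σ _ => ⟨?_, key σ⟩⟩
  · have h := key {L}
    rwa [Finset.sup_singleton, Finset.card_singleton] at h
  · intro L _ L' _ h
    by_contra hne
    have hc := (key {L, L'}).1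
    have h1 := (key {L}).1
    have h' := congrArg Subtype.val h
    dsimp only at h'
    rw [Finset.sup_insert, Finset.sup_singleton, h', sup_idem, Finset.card_pair hne] at hc
    rw [Finset.sup_singleton, h', Finset.card_singleton] at h1
    omega

/-- If there is a nondegenerate simplicial map from `K(F_p^n)` to `K(ℤ^r)`, then there is
one from `K(F_p^n)` to `K(F_q^r)`; consequently `ϑ_p(n) ≥ ς_{p,q}(n)` for the least such
`r`'s. -/
theorem nondeg_map_Z_to_Fq (p q n : ℕ) (hp : p.Prime) (hq : q.Prime) (hn : 0 < n) :
    (∀ r : ℕ, 0 < r → (∃ f, IsNondegMapKZ p n r f) → ∃ g, IsNondegMapK p q n r g) ∧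
    sInf {r : ℕ | 0 < r ∧ ∃ g, IsNondegMapK p q n r g} ≤
      sInf {r : ℕ | 0 < r ∧ ∃ f, IsNondegMapKZ p n r f} := by
  have hmap (r : ℕ) := exists_isNondegMapK_of_isNondegMapKZ p q n r hq
  refine ⟨fun r _ => hmap r, ?_⟩
  obtain ⟨hr, hf⟩ := Nat.sInf_mem (exists_isNondegMapKZ p n hp hn)
  exact Nat.sInf_le ⟨hr, hmap _ hf⟩
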